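/- Upper bound on the MIO distillation fidelity by the monotone Θ: for every d×d density matrix ρ and every integer m ≥ 1, max { Re Tr(Gρ) : G Hermitian, 0 ≤ G ≤ 𝟙, Δ(G) = (1/m)𝟙 } ≤ (1/m)·( Θ_{m−1}(ρ) + 1 ); equivalently, Θ^J_{m−1}(ρ) ≤ Θ_{m−1}(ρ). -/

import Mathlib

open Matrix Kronecker BigOperators ComplexOrder

/-- The completely dephasing map Δ, sending a matrix to its diagonal part. -/
noncomputable def deph {n : ℕ} (A : Matrix (Fin n) (Fin n) ℂ) : Matrix (Fin n) (Fin n) ℂ :=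
  Matrix.diagonal (fun i => A i i)

/-- A density matrix: positive semidefinite with unit trace. -/
def IsDensity {n : ℕ} (ρ : Matrix (Fin n) (Fin n) ℂ) : Prop :=
  ρ.PosSemidef ∧ ρ.trace = 1

/-- Θ_m(ρ) = sup { Re Tr(ρW) : W Hermitian, −𝟙 ≤ W ≤ m𝟙, Δ(W) ≤ 0 }. -/
noncomputable def Theta {d : ℕ} (m : ℝ) (ρ : Matrix (Fin d) (Fin d) ℂ) : ℝ :=
  sSup {x : ℝ | ∃ W : Matrix (Fin d) (Fin d) ℂ, W.IsHermitian ∧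
    (W + 1).PosSemidef ∧ ((m : ℂ) • (1 : Matrix (Fin d) (Fin d) ℂ) - W).PosSemidef ∧
    (-(deph W)).PosSemidef ∧ x = ((ρ * W).trace).re}

/-- Θ^J_m(ρ) = sup { Re Tr(ρW) : W Hermitian, −𝟙 ≤ W ≤ m𝟙, Δ(W) = 0 }. -/
noncomputable def ThetaJ {d : ℕ} (m : ℝ) (ρ : Matrix (Fin d) (Fin d) ℂ) : ℝ :=
  sSup {x : ℝ | ∃ W : Matrix (Fin d) (Fin d) ℂ, W.IsHermitian ∧
    (W + 1).PosSemidef ∧ ((m : ℂ) • (1 : Matrix (Fin d) (Fin d) ℂ) - W).PosSemidef ∧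
    deph W = 0 ∧ x = ((ρ * W).trace).re}

open scoped MatrixOrder Matrix.Norms.L2Operator in
/-- The trace of a product of two positive semidefinite matrices is nonnegative. -/
theorem Matrix.PosSemidef.trace_mul_nonneg {n : Type*} [Fintype n] [DecidableEq n]
    {A B : Matrix n n ℂ} (hA : A.PosSemidef) (hB : B.PosSemidef) : 0 ≤ (A * B).trace := by
  obtain ⟨C, rfl⟩ := CStarAlgebra.nonneg_iff_eq_star_mul_self.mp hA.nonneg
  rw [Matrix.mul_assoc, Matrix.trace_mul_comm]
  exact (hB.mul_mul_conjTranspose_same C).trace_nonneg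

/-- Each feasible `W` contributes a lower bound for `Theta`. -/
theorem re_trace_mul_le_Theta {d : ℕ} {m : ℝ} {ρ W : Matrix (Fin d) (Fin d) ℂ}
    (hρ : IsDensity ρ) (hW : W.IsHermitian) (hl : (W + 1).PosSemidef)
    (hu : ((m : ℂ) • (1 : Matrix (Fin d) (Fin d) ℂ) - W).PosSemidef)
    (hd : (-(deph W)).PosSemidef) : ((ρ * W).trace).re ≤ Theta m ρ := by
  refine le_csSup ⟨m, ?_⟩ ⟨W, hW, hl, hu, hd, rfl⟩
  rintro _ ⟨V, -, -, hV, -, rfl⟩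
  have h := (Complex.le_def.mp (hρ.1.trace_mul_nonneg hV)).1
  simpa [Matrix.mul_sub, hρ.2] using h

/-- upper bound on the MIO distillation fidelity SDP by Θ:
sup { Re Tr(Gρ) : 0 ≤ G ≤ 𝟙, Δ(G) = (1/m)𝟙 } ≤ (1/m)(Θ_{m−1}(ρ) + 1); equivalently
Θ^J_{m−1}(ρ) ≤ Θ_{m−1}(ρ). -/
theorem fidelity_le_theta {d : ℕ} (m : ℕ) (hm : 1 ≤ m)
    (ρ : Matrix (Fin d) (Fin d) ℂ) (hρ : IsDensity ρ) :
    (sSup {x : ℝ | ∃ G : Matrix (Fin d) (Fin d) ℂ, G.IsHermitian ∧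
        G.PosSemidef ∧ (1 - G).PosSemidef ∧
        deph G = ((m : ℂ))⁻¹ • (1 : Matrix (Fin d) (Fin d) ℂ) ∧
        x = ((ρ * G).trace).re} ≤
      (1 / (m : ℝ)) * (Theta ((m : ℝ) - 1) ρ + 1)) ∧
    ThetaJ ((m : ℝ) - 1) ρ ≤ Theta ((m : ℝ) - 1) ρ := by
  have hm0 : (0 : ℝ) < m := by exact_mod_cast hm
  have hmC : (m : ℂ) ≠ 0 := by exact_mod_cast hm0.ne'
  have hmnn : (0 : ℂ) ≤ (m : ℂ) := Nat.cast_nonneg m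
  refine ⟨csSup_le ?_ ?_, csSup_le ?_ ?_⟩
  · have hinv : (0 : ℂ) ≤ (m : ℂ)⁻¹ := by
      rw [← Complex.ofReal_natCast, ← Complex.ofReal_inv]
      exact Complex.zero_le_real.mpr (inv_nonneg.mpr hm0.le)
    have hsub : (0 : ℂ) ≤ 1 - (m : ℂ)⁻¹ := by
      have h : (0 : ℝ) ≤ 1 - (m : ℝ)⁻¹ :=
        sub_nonneg.mpr (inv_le_one_of_one_le₀ (by exact_mod_cast hm))
      simpa using Complex.zero_le_real.mpr h
    have hG : ((m : ℂ)⁻¹ • (1 : Matrix (Fin d) (Fin d) ℂ)).PosSemidef :=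
      PosSemidef.one.smul hinv
    refine ⟨_, _, hG.1, hG, ?_, ?_, rfl⟩
    · simpa [sub_smul] using
        (PosSemidef.one (n := Fin d) (R := ℂ)).smul hsub
    · ext i j
      by_cases h : i = j <;> simp [deph, h]
  · rintro _ ⟨G, hGh, hG, hG1, hGd, rfl⟩
    have hpsd : ((m : ℂ) • G).PosSemidef := hG.smul hmnn
    have key : ((ρ * ((m : ℂ) • G - 1)).trace).re ≤ Theta ((m : ℝ) - 1) ρ := by
      refine re_trace_mul_le_Theta hρ (hpsd.1.sub isHermitian_one) (by simpa using hpsd) ?_ ?_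
      · convert hG1.smul hmnn using 1
        push_cast
        module
      · have hz : deph ((m : ℂ) • G - 1) = 0 := by
          ext i j
          by_cases h : i = j
          · subst h
            have hi : G i i = (m : ℂ)⁻¹ := by simpa [deph] using congrFun (congrFun hGd i) i
            simp [deph, hi, hmC]
          · simp [deph, h]
        simpa [hz] using PosSemidef.zero
    have htr : ((ρ * ((m : ℂ) • G - 1)).trace).re = m * ((ρ * G).trace).re - 1 := by
      simp [Matrix.mul_sub, hρ.2]
    rw [htr] at key
    rw [one_div, le_inv_mul_iff₀ hm0]
    linarith
  · refine ⟨_, 0, isHermitian_zero, by simpa using PosSemidef.one, ?_, by simp [deph], rfl⟩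
    have h : (0 : ℂ) ≤ (((m : ℝ) - 1 : ℝ) : ℂ) :=
      Complex.zero_le_real.mpr (sub_nonneg.mpr (by exact_mod_cast hm))
    simpa only [sub_zero] using (PosSemidef.one (n := Fin d) (R := ℂ)).smul h
  · rintro _ ⟨W, hW, hl, hu, hd, rfl⟩
    exact re_trace_mul_le_Theta hρ hW hl hu (by simpa [hd] using PosSemidef.zero)
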